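/- Let Γ = {1,2,3} with the 3×3 matrix E = [[2,2,2],[1,1,2],[0,1,2]] and degrees |(-i)_1| = 2i-1, |(-i)_2| = 2i, |(-i)_3| = 2i+1 for i > 0. A colored partition over Γ × ℤ_{<0} is admissible if it contains no pair i_α i_β with E α β · E β α ≥ 1 and no pair (i-1)_α i_β with E α β = 2. Then for every n ≥ 0, the number of admissible colored partitions of degree n equals the number of partitions of n into odd parts. -/

import Mathlib

def E3 : Fin 3 → Fin 3 → ℕ :=
  ![![2, 2, 2],
    ![1, 1, 2],
    ![0, 1, 2]]

/-- Degrees `|(-j)_1| = 2j - 1`, `|(-j)_2| = 2j`, `|(-j)_3| = 2j + 1`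
(the principal specialization). -/
def deg3p (x : ℕ+ × Fin 3) : ℕ :=
  ![2 * (x.1 : ℕ) - 1, 2 * (x.1 : ℕ), 2 * (x.1 : ℕ) + 1] x.2

/-- A colored partition (a multiset of parts `(j, α)`, `j ∈ ℕ₊` standing for the
negative integer `-j`) satisfies the difference `𝒟` condition: it contains no pair
`i_α i_β` with `E α β ⬝ E β α ≥ 1`, and no pair `(i-1)_α i_β` with `E α β = 2`. -/
def Admissible {Γ : Type*} (E : Γ → Γ → ℕ) (π : Multiset (ℕ+ × Γ)) : Prop :=
  (∀ (j : ℕ+) (α β : Γ), ({(j, α), (j, β)} : Multiset (ℕ+ × Γ)) ≤ π → E α β * E β α = 0) ∧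
  (∀ (j : ℕ+) (α β : Γ), ({(j + 1, α), (j, β)} : Multiset (ℕ+ × Γ)) ≤ π → E α β ≠ 2)

section Helpers

open Finset

section QSums
variable {R : Type*} [CommRing R]

/-- `q ^ (m choose 2)` times the Gaussian binomial `[N, m]` in base `q`. -/
def gaussCoeff (q : R) : ℕ → ℕ → R
  | _, 0 => 1
  | 0, _ + 1 => 0
  | N + 1, m + 1 => gaussCoeff q N (m + 1) + q ^ N * gaussCoeff q N m

/-- `q ^ (m choose 2) * (-q; q)_m` times the Gaussian binomial `[N, m]` in base `q ^ 2`. -/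
def mixedCoeff (q : R) : ℕ → ℕ → R
  | _, 0 => 1
  | 0, _ + 1 => 0
  | N + 1, m + 1 => mixedCoeff q N (m + 1) +
      q ^ (2 * N - m) * (1 + q ^ (m + 1)) * mixedCoeff q N m

theorem gaussCoeff_zero_right (q : R) (N : ℕ) : gaussCoeff q N 0 = 1 := by
  cases N <;> rfl

theorem mixedCoeff_zero_right (q : R) (N : ℕ) : mixedCoeff q N 0 = 1 := by
  cases N <;> rfl

theorem gaussCoeff_eq_zero (q : R) {N m : ℕ} (h : N < m) : gaussCoeff q N m = 0 := by
  induction N generalizing m with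
  | zero => obtain ⟨m, rfl⟩ := Nat.exists_eq_succ_of_ne_zero h.ne'; rfl
  | succ N ih =>
    obtain ⟨m, rfl⟩ := Nat.exists_eq_succ_of_ne_zero (by omega : m ≠ 0)
    simp [gaussCoeff, ih (by omega : N < m), ih (by omega : N < m + 1)]

theorem mixedCoeff_eq_zero (q : R) {N m : ℕ} (h : N < m) : mixedCoeff q N m = 0 := by
  induction N generalizing m with
  | zero => obtain ⟨m, rfl⟩ := Nat.exists_eq_succ_of_ne_zero h.ne'; rfl
  | succ N ih =>
    obtain ⟨m, rfl⟩ := Nat.exists_eq_succ_of_ne_zero (by omega : m ≠ 0)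
    simp [mixedCoeff, ih (by omega : N < m), ih (by omega : N < m + 1)]

theorem gaussCoeff_ratio (q : R) (N m : ℕ) :
    (1 - q ^ (m + 1)) * gaussCoeff q N (m + 1) = (q ^ m - q ^ N) * gaussCoeff q N m := by
  induction N generalizing m with
  | zero => cases m <;> simp [gaussCoeff]
  | succ N ih =>
    cases m with
    | zero =>
      have h := ih 0
      simp only [gaussCoeff, gaussCoeff_zero_right] at h ⊢
      linear_combination h
    | succ m =>
      have h := ih (m + 1)
      have h' := ih m
      simp only [gaussCoeff]
      linear_combination h + q ^ (N + 1) * h'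

theorem mixedCoeff_ratio_aux (q : R) {N m : ℕ} (hm : m ≤ N)
    (h : (1 - q ^ (m + 1)) * mixedCoeff q N (m + 1) =
      (q ^ m - q ^ (2 * N - m)) * mixedCoeff q N m) :
    (1 - q ^ (m + 1)) * mixedCoeff q (N + 1) (m + 1) =
      q ^ m * (1 - q ^ (2 * N + 2)) * mixedCoeff q N m := by
  have e : q ^ (2 * N + 2 + m) = q ^ (2 * N - m) * q ^ (2 * m + 2) := by
    rw [← pow_add]; congr 1; omega
  simp only [mixedCoeff]
  linear_combination h + mixedCoeff q N m * e

theorem mixedCoeff_ratio [IsDomain R] {q : R} (hq : ∀ m : ℕ, 1 - q ^ (m + 1) ≠ 0)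
    {N m : ℕ} (hm : m ≤ N) :
    (1 - q ^ (m + 1)) * mixedCoeff q N (m + 1) =
      (q ^ m - q ^ (2 * N - m)) * mixedCoeff q N m := by
  induction N generalizing m with
  | zero => obtain rfl : m = 0 := by omega
            simp [mixedCoeff]
  | succ N ih =>
    rcases Nat.lt_or_ge N m with h | h
    · obtain rfl : m = N + 1 := by omega
      rw [mixedCoeff_eq_zero q (Nat.lt_succ_self _), show 2 * (N + 1) - (N + 1) = N + 1 by omega]
      ring
    rw [mixedCoeff_ratio_aux q h (ih h)]
    cases m with
    | zero => simp only [mixedCoeff_zero_right]; simp [mul_add]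
    | succ m =>
      have h1 := mixedCoeff_ratio_aux q (by omega) (ih (by omega : m ≤ N))
      have h2 := ih (by omega : m ≤ N)
      apply mul_left_cancel₀ (hq m)
      obtain ⟨k, rfl⟩ := Nat.exists_eq_add_of_le h
      have e1 : 2 * (m + 1 + k) - m = m + 2 * k + 2 := by omega
      have e2 : 2 * (m + 1 + k + 1) - (m + 1) = m + 2 * k + 3 := by omega
      rw [e1] at h2
      rw [e2]
      linear_combination q ^ (m + 1) * (1 - q ^ (2 * (m + 1 + k) + 2)) * h2 -
        (q ^ (m + 1) - q ^ (m + 2 * k + 3)) * h1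

theorem mixedCoeff_succ_succ' [IsDomain R] {q : R} (hq : ∀ m : ℕ, 1 - q ^ (m + 1) ≠ 0)
    {N m : ℕ} (hm : m ≤ N) :
    mixedCoeff q (N + 1) (m + 1) = q ^ (2 * m + 2) * mixedCoeff q N (m + 1) +
      q ^ m * (1 + q ^ (m + 1)) * mixedCoeff q N m := by
  apply mul_left_cancel₀ (hq m)
  have h := mixedCoeff_ratio hq hm
  have e : q ^ (2 * N + 2 + m) = q ^ (2 * N - m) * q ^ (2 * m + 2) := by
    rw [← pow_add]; congr 1; omega
  rw [mixedCoeff_ratio_aux q hm h]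
  linear_combination - q ^ (2 * m + 2) * h - mixedCoeff q N m * e

theorem sum_gaussCoeff (q : R) (N : ℕ) :
    ∑ m ∈ range (N + 1), gaussCoeff q N m = ∏ i ∈ range N, (1 + q ^ i) := by
  induction N with
  | zero => simp [gaussCoeff]
  | succ N ih =>
    rw [prod_range_succ, ← ih, sum_range_succ']
    simp only [gaussCoeff, sum_add_distrib, ← mul_sum]
    have h : ∑ m ∈ range (N + 1), gaussCoeff q N m =
        ∑ m ∈ range (N + 1), gaussCoeff q N (m + 1) + 1 := by
      rw [← gaussCoeff_zero_right q N, ← sum_range_succ', sum_range_succ _ (N + 1),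
        gaussCoeff_eq_zero q (Nat.lt_succ_self N), add_zero]
    linear_combination -h

theorem sum_range_shift_of_last_eq_zero (f : ℕ → R) {N : ℕ} (h : f (N + 1) = 0) :
    ∑ m ∈ range (N + 1), f (m + 1) = ∑ m ∈ range (N + 1), f m - f 0 := by
  rw [eq_sub_iff_add_eq, ← sum_range_succ', sum_range_succ _ (N + 1), h, add_zero]

theorem sum_mixedCoeff_ratio [IsDomain R] {q : R} (hq : ∀ m : ℕ, 1 - q ^ (m + 1) ≠ 0) (N : ℕ) :
    2 * ∑ m ∈ range (N + 1), q ^ m * mixedCoeff q N m =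
      ∑ m ∈ range (N + 1), mixedCoeff q N m +
        ∑ m ∈ range (N + 1), q ^ (2 * N - m) * mixedCoeff q N m := by
  have h := sum_range_shift_of_last_eq_zero (fun m => (1 - q ^ m) * mixedCoeff q N m) (N := N)
    (by simp [mixedCoeff_eq_zero q (Nat.lt_succ_self N)])
  rw [sum_congr rfl fun m hm => mixedCoeff_ratio hq (Nat.lt_succ_iff.1 (mem_range.1 hm))] at h
  simp only [sub_mul, sum_sub_distrib, one_mul, pow_zero, sub_self] at h
  linear_combination h

theorem sum_mixedCoeff_succ [IsDomain R] {q : R} (hq : ∀ m : ℕ, 1 - q ^ (m + 1) ≠ 0) (N : ℕ) :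
    ∑ m ∈ range (N + 2), mixedCoeff q (N + 1) m =
      2 * ∑ m ∈ range (N + 1), q ^ m * mixedCoeff q N m +
        q ^ (2 * N + 1) * ∑ m ∈ range (N + 1), mixedCoeff q N m := by
  have h := sum_range_shift_of_last_eq_zero (fun m => mixedCoeff q N m) (N := N)
    (mixedCoeff_eq_zero q (Nat.lt_succ_self N))
  have e : ∀ m ∈ range (N + 1), mixedCoeff q (N + 1) (m + 1) = mixedCoeff q N (m + 1) +
      q ^ (2 * N - m) * mixedCoeff q N m + q ^ (2 * N + 1) * mixedCoeff q N m := by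
    intro m hm
    have : q ^ (2 * N + 1) = q ^ (2 * N - m) * q ^ (m + 1) := by
      rw [← pow_add]; congr 1; have := mem_range.1 hm; omega
    rw [this, mixedCoeff]
    ring
  rw [sum_range_succ', sum_congr rfl e, sum_mixedCoeff_ratio hq]
  simp only [sum_add_distrib, ← mul_sum, h, mixedCoeff_zero_right]
  ring

theorem two_mul_sum_pow_mul_mixedCoeff_succ [IsDomain R] {q : R}
    (hq : ∀ m : ℕ, 1 - q ^ (m + 1) ≠ 0) (N : ℕ) :
    2 * ∑ m ∈ range (N + 2), q ^ m * mixedCoeff q (N + 1) m =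
      2 * ((1 + q ^ (2 * N + 2)) * ∑ m ∈ range (N + 1), q ^ m * mixedCoeff q N m +
        q ^ (2 * N + 1) * ∑ m ∈ range (N + 1), mixedCoeff q N m) := by
  have h := sum_range_shift_of_last_eq_zero (fun m => q ^ m * mixedCoeff q N m) (N := N)
    (by simp [mixedCoeff_eq_zero q (Nat.lt_succ_self N)])
  have e : ∀ m ∈ range (N + 1), q ^ (2 * (N + 1) - (m + 1)) * mixedCoeff q (N + 1) (m + 1) =
      q ^ (2 * N + 2) * (q ^ (m + 1) * mixedCoeff q N (m + 1)) +
      q ^ (2 * N + 1) * mixedCoeff q N m + q ^ (2 * N + 2) * (q ^ m * mixedCoeff q N m) := by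
    intro m hm
    have hm := mem_range.1 hm
    obtain ⟨k, rfl⟩ := Nat.exists_eq_add_of_le (Nat.lt_succ_iff.1 hm)
    rw [mixedCoeff_succ_succ' hq (by omega),
      show 2 * (m + k + 1) - (m + 1) = m + 2 * k + 1 by omega]
    ring
  rw [sum_mixedCoeff_ratio hq, sum_mixedCoeff_succ hq, sum_range_succ' _ (N + 1),
    sum_congr rfl e]
  simp only [sum_add_distrib, ← mul_sum, h, mixedCoeff_zero_right]
  simp only [Nat.sub_zero, pow_zero]
  ring

end QSums

open PowerSeries in
theorem X_pow_dvd_mixedCoeff_sub_gaussCoeff {N m : ℕ} (hm : m ≤ N) :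
    (X : PowerSeries ℤ) ^ N ∣ mixedCoeff X N m - gaussCoeff X N m := by
  have hq : ∀ m : ℕ, IsUnit (1 - (X : PowerSeries ℤ) ^ (m + 1)) := fun m => by
    rw [PowerSeries.isUnit_iff_constantCoeff]; simp
  induction m with
  | zero => simp [mixedCoeff_zero_right, gaussCoeff_zero_right]
  | succ m ih =>
    rw [← (hq m).dvd_mul_left, mul_sub, mixedCoeff_ratio (fun m => (hq m).ne_zero) (by omega),
      gaussCoeff_ratio]
    obtain ⟨d, hd⟩ := ih (by omega)
    obtain ⟨k, rfl⟩ := Nat.exists_eq_add_of_le hm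
    refine ⟨X ^ m * d - X ^ (k + 1) * mixedCoeff X (m + 1 + k) m + gaussCoeff X (m + 1 + k) m, ?_⟩
    rw [show 2 * (m + 1 + k) - m = m + 1 + k + (k + 1) by omega]
    linear_combination X ^ m * hd

open PowerSeries in
/-- A solution of the transfer recurrence stabilizes to `∏ (1 + X ^ i)`. -/
theorem coeff_eq_coeff_prod_of_transfer {t u : ℕ → PowerSeries ℤ} (t0 : t 0 = 1) (t1 : t 1 = 1)
    (u0 : u 0 = 1)
    (hu : ∀ n, u (n + 1) = t (n + 1) + X ^ (2 * n + 1) * t n + X ^ (2 * n + 2) * u n)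
    (ht : ∀ n, t (n + 2) = u (n + 1) + X ^ (2 * n + 3) * u n + X ^ (4 * n + 4) * t n)
    {N d : ℕ} (hd : d ≤ N) :
    coeff d (t (N + 1)) = coeff d (∏ i ∈ range N, (1 + (X : PowerSeries ℤ) ^ (i + 1))) := by
  have hq : ∀ m : ℕ, 1 - (X : PowerSeries ℤ) ^ (m + 1) ≠ 0 := fun m => by
    apply IsUnit.ne_zero
    rw [PowerSeries.isUnit_iff_constantCoeff]; simp
  have two_ne : (2 : PowerSeries ℤ) ≠ 0 := fun h => by
    have h2 := congrArg (constantCoeff (R := ℤ)) h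
    rw [map_ofNat, map_zero] at h2
    exact two_ne_zero h2
  set P : ℕ → PowerSeries ℤ := fun N => ∑ m ∈ range (N + 1), mixedCoeff X N m with hP
  set S : ℕ → PowerSeries ℤ := fun N => ∑ m ∈ range (N + 1), X ^ m * mixedCoeff X N m with hS
  have P0 : P 0 = 1 := by simp [hP, mixedCoeff]
  have S0 : S 0 = 1 := by simp [hS, mixedCoeff]
  have P_succ : ∀ n, P (n + 1) = 2 * S n + X ^ (2 * n + 1) * P n := sum_mixedCoeff_succ hq
  have S_succ : ∀ n, S (n + 1) = (1 + X ^ (2 * n + 2)) * S n + X ^ (2 * n + 1) * P n := fun n =>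
    mul_left_cancel₀ two_ne (two_mul_sum_pow_mul_mixedCoeff_succ hq n)
  have key : ∀ n, u n = S n ∧ 2 * t n = P n + (-1) ^ n * X ^ (n ^ 2) ∧
      2 * t (n + 1) = P (n + 1) + (-1) ^ (n + 1) * X ^ ((n + 1) ^ 2) := by
    intro n
    induction n with
    | zero =>
      refine ⟨by rw [u0, S0], by rw [t0, P0]; norm_num, ?_⟩
      rw [t1, P_succ, P0, S0]
      ring
    | succ n ih =>
      obtain ⟨h1, h2, h3⟩ := ih
      have h4 : u (n + 1) = S (n + 1) := by
        apply mul_left_cancel₀ two_ne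
        rw [hu, S_succ, h1]
        linear_combination h3 + X ^ (2 * n + 1) * h2 + P_succ n
      refine ⟨h4, h3, ?_⟩
      rw [ht, P_succ (n + 1), P_succ n, h1, h4]
      linear_combination X ^ (4 * n + 4) * h2
  have hdvd : (X : PowerSeries ℤ) ^ (N + 1) ∣
      2 * t (N + 1) - 2 * ∏ i ∈ range N, (1 + (X : PowerSeries ℤ) ^ (i + 1)) := by
    have h := sum_gaussCoeff (X : PowerSeries ℤ) (N + 1)
    rw [prod_range_succ'] at h
    have e : 2 * t (N + 1) - 2 * ∏ i ∈ range N, (1 + (X : PowerSeries ℤ) ^ (i + 1)) =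
        ∑ m ∈ range (N + 2), (mixedCoeff X (N + 1) m - gaussCoeff X (N + 1) m) +
          (-1) ^ (N + 1) * X ^ ((N + 1) ^ 2) := by
      rw [(key N).2.2, sum_sub_distrib, h]
      ring
    rw [e]
    refine dvd_add (dvd_sum fun m hm =>
      X_pow_dvd_mixedCoeff_sub_gaussCoeff (Nat.lt_succ_iff.1 (mem_range.1 hm))) ?_
    exact Dvd.dvd.mul_left (pow_dvd_pow _ (Nat.le_self_pow two_ne_zero _)) _
  have h := (X_pow_dvd_iff.1 hdvd) d (by omega)
  rw [← mul_sub, two_mul, map_add, map_sub] at h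
  omega

/-- Admissibility for `E3` of a set of parts, the level `k` standing for the integer `-(k + 1)`. -/
def AdmissibleSet (s : Finset (ℕ × Fin 3)) : Prop :=
  ∀ k, ¬((k, 0) ∈ s ∧ (k, 1) ∈ s) ∧ ¬((k, 1) ∈ s ∧ (k, 2) ∈ s) ∧
    ((k + 1, 0) ∈ s → (k, 0) ∉ s ∧ (k, 1) ∉ s) ∧
    ((k, 2) ∈ s → (k + 1, 0) ∉ s ∧ (k + 1, 1) ∉ s ∧ (k + 1, 2) ∉ s)

/-- The degree of the part of level `k`. -/
def levelDeg (x : ℕ × Fin 3) : ℕ := 2 * x.1 + 1 + x.2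

open Classical in
/-- Admissible sets with all levels below `N - 1`. -/
noncomputable def admissibleBelow (N : ℕ) : Finset (Finset (ℕ × Fin 3)) :=
  (range (N - 1) ×ˢ univ).powerset.filter AdmissibleSet

/-- Admissible sets with all levels below `n` and no part of the largest possible degree. -/
noncomputable def admissibleTrunc (n : ℕ) : Finset (Finset (ℕ × Fin 3)) :=
  (admissibleBelow (n + 1)).filter fun s => (n - 1, 2) ∉ s

theorem forall_fin_three {p : Fin 3 → Prop} : (∀ c, p c) ↔ p 0 ∧ p 1 ∧ p 2 := by
  simp [Fin.forall_fin_succ]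

theorem mem_admissibleBelow {N : ℕ} {s : Finset (ℕ × Fin 3)} :
    s ∈ admissibleBelow N ↔ AdmissibleSet s ∧
      ∀ k, ((k, 0) ∈ s → k + 1 < N) ∧ ((k, 1) ∈ s → k + 1 < N) ∧ ((k, 2) ∈ s → k + 1 < N) := by
  simp only [admissibleBelow, mem_filter, mem_powerset, subset_iff, mem_product, mem_range,
    mem_univ, and_true, Prod.forall, forall_fin_three]
  rw [and_comm]
  simp only [Nat.lt_sub_iff_add_lt]

theorem mem_admissibleTrunc {n : ℕ} {s : Finset (ℕ × Fin 3)} :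
    s ∈ admissibleTrunc n ↔ AdmissibleSet s ∧
      ∀ k, ((k, 0) ∈ s → k < n) ∧ ((k, 1) ∈ s → k < n) ∧ ((k, 2) ∈ s → k + 1 < n) := by
  simp only [admissibleTrunc, mem_filter, mem_admissibleBelow]
  grind

theorem sum_pow_sum_eq_of_erase {α R : Type*} [DecidableEq α] [CommSemiring R] (q : R)
    (w : α → ℕ) (x : α) {F G : Finset (Finset α)} (hF : ∀ s ∈ F, x ∉ s ∧ insert x s ∈ G)
    (hG : ∀ s ∈ G, x ∈ s ∧ s.erase x ∈ F) :
    ∑ s ∈ G, q ^ (∑ y ∈ s, w y) = q ^ w x * ∑ s ∈ F, q ^ (∑ y ∈ s, w y) := by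
  rw [mul_sum]
  refine sum_bij' (fun s _ => s.erase x) (fun s _ => insert x s) (fun s hs => (hG s hs).2)
    (fun s hs => (hF s hs).2) (fun s hs => insert_erase (hG s hs).1)
    (fun s hs => erase_insert (hF s hs).1) fun s hs => ?_
  rw [← pow_add, add_sum_erase _ _ (hG s hs).1]

section GenFun
variable {R : Type*} [CommRing R]

/-- The generating polynomial of a family of sets of parts. -/
def degGenFun (q : R) (F : Finset (Finset (ℕ × Fin 3))) : R :=
  ∑ s ∈ F, q ^ ∑ x ∈ s, levelDeg x

theorem degGenFun_filter_add (q : R) (F : Finset (Finset (ℕ × Fin 3))) (x : ℕ × Fin 3) :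
    degGenFun q F =
      degGenFun q (F.filter (x ∈ ·)) + degGenFun q (F.filter (x ∉ ·)) :=
  (sum_filter_add_sum_filter_not _ _ _).symm

theorem degGenFun_of_erase (q : R) (x : ℕ × Fin 3) {F G : Finset (Finset (ℕ × Fin 3))}
    (hF : ∀ s ∈ F, x ∉ s ∧ insert x s ∈ G) (hG : ∀ s ∈ G, x ∈ s ∧ s.erase x ∈ F) :
    degGenFun q G = q ^ levelDeg x * degGenFun q F :=
  sum_pow_sum_eq_of_erase q levelDeg x hF hG

theorem degGenFun_trunc_filter_zero_mem (q : R) (n : ℕ) :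
    degGenFun q ((admissibleTrunc (n + 1)).filter ((n, 0) ∈ ·)) =
      q ^ (2 * n + 1) * degGenFun q (admissibleBelow n) := by
  refine degGenFun_of_erase q (n, 0) (fun s hs => ?_) fun s hs => ?_
  · simp only [mem_filter, mem_admissibleTrunc, mem_admissibleBelow, AdmissibleSet, mem_insert,
      Prod.mk.injEq] at *
    grind
  · simp only [mem_filter, mem_admissibleTrunc, mem_admissibleBelow, AdmissibleSet, mem_erase,
      ne_eq, Prod.mk.injEq] at *
    grind (splits := 20)

theorem degGenFun_trunc_filter_one_mem (q : R) (n : ℕ) :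
    degGenFun q (((admissibleTrunc (n + 1)).filter ((n, 0) ∉ ·)).filter ((n, 1) ∈ ·)) =
      q ^ (2 * n + 2) * degGenFun q (admissibleTrunc n) := by
  refine degGenFun_of_erase q (n, 1) (fun s hs => ?_) fun s hs => ?_
  · simp only [mem_filter, mem_admissibleTrunc, AdmissibleSet, mem_insert,
      Prod.mk.injEq] at *
    grind
  · simp only [mem_filter, mem_admissibleTrunc, AdmissibleSet, mem_erase,
      ne_eq, Prod.mk.injEq] at *
    grind

theorem degGenFun_trunc_filter_not_mem (q : R) (n : ℕ) :
    degGenFun q (((admissibleTrunc (n + 1)).filter ((n, 0) ∉ ·)).filter ((n, 1) ∉ ·)) =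
      degGenFun q (admissibleBelow (n + 1)) := by
  congr 1
  ext s
  simp only [mem_filter, mem_admissibleTrunc, mem_admissibleBelow]
  grind

theorem degGenFun_trunc_succ (q : R) (n : ℕ) :
    degGenFun q (admissibleTrunc (n + 1)) = degGenFun q (admissibleBelow (n + 1)) +
      q ^ (2 * n + 1) * degGenFun q (admissibleBelow n) +
      q ^ (2 * n + 2) * degGenFun q (admissibleTrunc n) := by
  rw [degGenFun_filter_add q _ (n, 0), degGenFun_filter_add q (filter ((n, 0) ∉ ·) _) (n, 1),
    degGenFun_trunc_filter_zero_mem, degGenFun_trunc_filter_one_mem,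
    degGenFun_trunc_filter_not_mem]
  ring

theorem degGenFun_below_filter_not_mem (q : R) (n : ℕ) :
    degGenFun q ((admissibleBelow (n + 2)).filter ((n, 2) ∉ ·)) =
      degGenFun q (admissibleTrunc (n + 1)) := by
  congr 1

theorem degGenFun_below_filter_mem_mem (q : R) (n : ℕ) :
    degGenFun q (((admissibleBelow (n + 2)).filter ((n, 2) ∈ ·)).filter ((n, 0) ∈ ·)) =
      q ^ (2 * n + 3) * degGenFun q ((admissibleTrunc (n + 1)).filter ((n, 0) ∈ ·)) := by
  refine degGenFun_of_erase q (n, 2) (fun s hs => ?_) fun s hs => ?_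
  · simp only [mem_filter, mem_admissibleTrunc, mem_admissibleBelow, AdmissibleSet, mem_insert,
      Prod.mk.injEq] at *
    grind
  · simp only [mem_filter, mem_admissibleTrunc, mem_admissibleBelow, AdmissibleSet, mem_erase,
      ne_eq, Prod.mk.injEq] at *
    grind

theorem degGenFun_below_filter_mem_not_mem (q : R) (n : ℕ) :
    degGenFun q (((admissibleBelow (n + 2)).filter ((n, 2) ∈ ·)).filter ((n, 0) ∉ ·)) =
      q ^ (2 * n + 3) * degGenFun q (admissibleTrunc n) := by
  refine degGenFun_of_erase q (n, 2) (fun s hs => ?_) fun s hs => ?_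
  · simp only [mem_filter, mem_admissibleTrunc, mem_admissibleBelow, AdmissibleSet, mem_insert,
      Prod.mk.injEq] at *
    grind
  · simp only [mem_filter, mem_admissibleTrunc, mem_admissibleBelow, AdmissibleSet, mem_erase,
      ne_eq, Prod.mk.injEq] at *
    grind

theorem degGenFun_below_succ_succ (q : R) (n : ℕ) :
    degGenFun q (admissibleBelow (n + 2)) = degGenFun q (admissibleTrunc (n + 1)) +
      q ^ (2 * n + 3) * degGenFun q (admissibleTrunc n) +
      q ^ (4 * n + 4) * degGenFun q (admissibleBelow n) := by
  rw [degGenFun_filter_add q _ (n, 2), degGenFun_filter_add q (filter ((n, 2) ∈ ·) _) (n, 0),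
    degGenFun_below_filter_mem_mem, degGenFun_below_filter_mem_not_mem,
    degGenFun_below_filter_not_mem, degGenFun_trunc_filter_zero_mem]
  ring

theorem admissibleBelow_eq_singleton {N : ℕ} (hN : N ≤ 1) : admissibleBelow N = {∅} := by
  have : N - 1 = 0 := by omega
  simp [admissibleBelow, this, filter_singleton, AdmissibleSet]

theorem admissibleTrunc_zero : admissibleTrunc 0 = {∅} := by
  simp [admissibleTrunc, admissibleBelow_eq_singleton, filter_singleton]

theorem degGenFun_singleton_empty (q : R) : degGenFun q {∅} = 1 := by
  simp [degGenFun]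

end GenFun

theorem coeff_degGenFun_X (n : ℕ) (F : Finset (Finset (ℕ × Fin 3))) :
    PowerSeries.coeff n (degGenFun (PowerSeries.X : PowerSeries ℤ) F) =
      #{s ∈ F | ∑ x ∈ s, levelDeg x = n} := by
  simp [degGenFun, map_sum, PowerSeries.coeff_X_pow, eq_comm]

/-- The bijection between levels and positive integers. -/
def levelEmb : ℕ × Fin 3 ↪ ℕ+ × Fin 3 :=
  Equiv.pnatEquivNat.symm.toEmbedding.prodMap (Function.Embedding.refl _)

theorem levelEmb_mk (k : ℕ) (c : Fin 3) : levelEmb (k, c) = (k.succPNat, c) := rfl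

theorem levelEmb_surjective : Function.Surjective levelEmb := fun ⟨j, c⟩ =>
  ⟨(j.natPred, c), by rw [levelEmb_mk, PNat.succPNat_natPred]⟩

theorem deg3p_levelEmb (x : ℕ × Fin 3) : deg3p (levelEmb x) = levelDeg x := by
  obtain ⟨k, c⟩ := x
  fin_cases c <;> simp [levelEmb_mk, deg3p, levelDeg] <;> omega

theorem pair_le_val_iff {α : Type*} {t : Finset α} {a b : α} :
    ({a, b} : Multiset α) ≤ t.val ↔ a ≠ b ∧ a ∈ t ∧ b ∈ t := by
  constructor
  · intro h
    refine ⟨?_, Multiset.mem_of_le h (by simp), Multiset.mem_of_le h (by simp)⟩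
    simpa using Multiset.nodup_of_le h t.nodup
  · rintro ⟨hab, ha, hb⟩
    refine (Multiset.le_iff_subset (by simpa using hab)).2 fun x hx => ?_
    simp only [Multiset.insert_eq_cons, Multiset.mem_cons, Multiset.mem_singleton] at hx
    rcases hx with rfl | rfl <;> assumption

theorem forall_pnat_iff_succPNat {p : ℕ+ → Prop} : (∀ j, p j) ↔ ∀ k : ℕ, p k.succPNat :=
  ⟨fun h k => h _, fun h j => by simpa using h j.natPred⟩

theorem admissible_map_levelEmb (s : Finset (ℕ × Fin 3)) :
    Admissible E3 (s.map levelEmb).val ↔ AdmissibleSet s := by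
  have hmem : ∀ k c, (Nat.succPNat k, c) ∈ s.map levelEmb ↔ (k, c) ∈ s := fun k c => by
    rw [← levelEmb_mk, mem_map' levelEmb]
  have hsucc : ∀ k : ℕ, k.succPNat + 1 = (k + 1).succPNat := fun k => rfl
  simp only [Admissible, pair_le_val_iff, forall_pnat_iff_succPNat, hsucc, hmem, forall_fin_three,
    AdmissibleSet]
  simp [E3]
  grind

theorem Admissible.nodup {π : Multiset (ℕ+ × Fin 3)} (h : Admissible E3 π) : π.Nodup := by
  rw [Multiset.nodup_iff_le]
  rintro ⟨j, c⟩ hle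
  have := h.1 j c c hle
  revert this
  fin_cases c <;> decide

theorem card_admissible (n : ℕ) :
    Nat.card {π : Multiset (ℕ+ × Fin 3) // Admissible E3 π ∧ (π.map deg3p).sum = n} =
      #{s ∈ admissibleBelow (n + 1) | ∑ x ∈ s, levelDeg x = n} := by
  have hsum : ∀ s : Finset (ℕ × Fin 3),
      ((s.map levelEmb).val.map deg3p).sum = ∑ x ∈ s, levelDeg x := fun s => by
    rw [map_val, Multiset.map_map]
    exact sum_congr rfl fun x _ => deg3p_levelEmb x
  have hlevel : ∀ s : Finset (ℕ × Fin 3), ∑ x ∈ s, levelDeg x = n →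
      ∀ k c, (k, c) ∈ s → k + 1 < n + 1 := fun s hs k c hk => by
    have := single_le_sum (f := levelDeg) (fun _ _ => Nat.zero_le _) hk
    simp only [levelDeg] at this hs
    omega
  rw [← Nat.card_eq_finsetCard]
  symm
  refine Nat.card_eq_of_bijective (fun s => ⟨(s.1.map levelEmb).val, ?_, ?_⟩) ⟨?_, ?_⟩
  · rw [admissible_map_levelEmb]
    exact (mem_admissibleBelow.1 (mem_filter.1 s.2).1).1
  · rw [hsum]
    exact (mem_filter.1 s.2).2
  · intro s t h
    exact Subtype.ext (map_injective levelEmb (val_injective (Subtype.ext_iff.1 h)))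
  · rintro ⟨π, hπ, hdeg⟩
    obtain ⟨s, hs⟩ : ∃ s : Finset (ℕ × Fin 3), s.map levelEmb = ⟨π, hπ.nodup⟩ := by
      refine ⟨(⟨π, hπ.nodup⟩ : Finset _).map (Equiv.ofBijective levelEmb
        ⟨levelEmb.injective, levelEmb_surjective⟩).symm.toEmbedding, ?_⟩
      ext x
      simp only [mem_map (f := levelEmb), mem_map_equiv, Prod.exists]
      constructor
      · rintro ⟨a, b, h, rfl⟩
        exact h
      · intro h
        obtain ⟨⟨a, b⟩, rfl⟩ := levelEmb_surjective x
        exact ⟨a, b, h, rfl⟩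
    have hval : (s.map levelEmb).val = π := by rw [hs]
    subst hval
    rw [hsum] at hdeg
    rw [admissible_map_levelEmb] at hπ
    have hl := hlevel s hdeg
    exact ⟨⟨s, mem_filter.2 ⟨mem_admissibleBelow.2
      ⟨hπ, fun k => ⟨hl k 0, hl k 1, hl k 2⟩⟩, hdeg⟩⟩, rfl⟩

theorem card_odd_multiset (n : ℕ) :
    Nat.card {μ : Multiset ℕ+ //
        (∀ i ∈ μ, Odd (i : ℕ)) ∧ (μ.map (fun i => (i : ℕ))).sum = n} = #(Nat.Partition.odds n) := by
  have hcoe : ∀ μ : Multiset ℕ+, (do let a ← μ; pure (a : ℕ)) = μ.map PNat.val := fun μ => by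
    simp [Multiset.bind_def, Multiset.pure_def]
  rw [← Nat.card_eq_finsetCard]
  simp only [hcoe, Multiset.map_id']
  refine Nat.card_eq_of_bijective (fun μ => ⟨⟨μ.1.map PNat.val, ?_, μ.2.2⟩, ?_⟩) ⟨?_, ?_⟩
  · intro i hi
    obtain ⟨j, -, rfl⟩ := Multiset.mem_map.1 hi
    exact j.pos
  · simpa [Nat.Partition.odds, Nat.Partition.restricted] using μ.2.1
  · intro μ ν h
    simp only [Subtype.mk.injEq, Nat.Partition.mk.injEq] at h
    exact Subtype.ext (Multiset.map_injective PNat.coe_injective h)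
  · rintro ⟨⟨parts, hpos, hsum⟩, hp⟩
    lift parts to Multiset ℕ+ using fun i hi => hpos hi
    refine ⟨⟨parts, ?_, hsum⟩, rfl⟩
    simpa [Nat.Partition.odds, Nat.Partition.restricted] using hp

theorem coeff_prod_one_add_X_pow (n : ℕ) :
    PowerSeries.coeff n (∏ i ∈ range n, (1 + (PowerSeries.X : PowerSeries ℤ) ^ (i + 1))) =
      (#(Nat.Partition.distincts n) : ℤ) := by
  have h : PowerSeries.coeff n (∏ i ∈ range n, (1 + (PowerSeries.X : PowerSeries ℤ) ^ (i + 1))) =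
      (#{s ∈ (range n).powerset | ∑ i ∈ s, (i + 1) = n} : ℤ) := by
    simp [prod_one_add, prod_pow_eq_pow_sum, PowerSeries.coeff_X_pow, eq_comm]
  rw [h, Nat.cast_inj]
  refine card_bij (fun s hs => ⟨s.val.map (· + 1), ?_, (mem_filter.1 hs).2⟩) ?_ ?_ ?_
  · intro i hi
    obtain ⟨j, -, rfl⟩ := Multiset.mem_map.1 hi
    exact j.succ_pos
  · intro s hs
    simp [Nat.Partition.distincts, Multiset.nodup_map_iff_of_injective (add_left_injective 1),
      s.nodup]
  · intro s _ t _ h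
    exact val_injective
      (Multiset.map_injective (add_left_injective 1) (congrArg Nat.Partition.parts h))
  · intro p hp
    have hnodup : p.parts.Nodup := by simpa [Nat.Partition.distincts] using hp
    have hmap : (p.parts.map Nat.pred).map (· + 1) = p.parts := by
      rw [Multiset.map_map]
      conv_rhs => rw [← Multiset.map_id p.parts]
      exact Multiset.map_congr rfl fun i hi => Nat.succ_pred_eq_of_pos (p.parts_pos hi)
    have hnodup' : (p.parts.map Nat.pred).Nodup := by
      rw [← hmap] at hnodup
      exact hnodup.of_map _
    refine ⟨⟨p.parts.map Nat.pred, hnodup'⟩, mem_filter.2 ⟨mem_powerset.2 fun i hi => ?_, ?_⟩, ?_⟩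
    · obtain ⟨j, hj, rfl⟩ := Multiset.mem_map.1 (show i ∈ p.parts.map Nat.pred from hi)
      have h1 := p.parts_pos hj
      have h2 := Multiset.le_sum_of_mem hj
      rw [p.parts_sum] at h2
      rw [mem_range]
      exact lt_of_lt_of_le (Nat.pred_lt h1.ne') h2
    · change ((p.parts.map Nat.pred).map (· + 1)).sum = n
      rw [hmap, p.parts_sum]
    · exact Nat.Partition.ext hmap

end Helpers

/-- Identity (4.1): admissible colored partitions of `n` for the "almost perfect"
`A_1^{(1)}`-crystal are counted by partitions of `n` into odd parts. -/
theorem almost_perfect_identity (n : ℕ) :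
    Nat.card {π : Multiset (ℕ+ × Fin 3) //
        Admissible E3 π ∧ (π.map deg3p).sum = n}
      = Nat.card {μ : Multiset ℕ+ //
          (∀ i ∈ μ, Odd (i : ℕ)) ∧ (μ.map (fun i => (i : ℕ))).sum = n} := by
  have transfer := coeff_eq_coeff_prod_of_transfer
    (t := fun N => degGenFun (PowerSeries.X : PowerSeries ℤ) (admissibleBelow N))
    (u := fun m => degGenFun (PowerSeries.X : PowerSeries ℤ) (admissibleTrunc m))
    (by simp only [admissibleBelow_eq_singleton zero_le_one, degGenFun_singleton_empty])
    (by simp only [admissibleBelow_eq_singleton le_rfl, degGenFun_singleton_empty])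
    (by simp only [admissibleTrunc_zero, degGenFun_singleton_empty])
    (degGenFun_trunc_succ _) (degGenFun_below_succ_succ _) (le_refl n)
  rw [coeff_degGenFun_X, coeff_prod_one_add_X_pow, Nat.cast_inj] at transfer
  rw [card_admissible, card_odd_multiset, Nat.Partition.card_odds_eq_card_distincts]
  exact transfer
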